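/- arXiv:2103.02468 — 2 statements merged into one kernel-verified Lean document; each statement's English description precedes it below -/
import Mathlib

section
/- There are universal constants C₁, C₂ > 0 such that the following holds. Let 𝒮 = (|ψ⟩, A) be a symmetric strategy with question set 𝒳, answer set 𝒜, ν a distribution on 𝒳, and δ = δ_sync(𝒮; ν). Let ρ be the reduced density of |ψ⟩ on H. Then there exists a family of projective measurements {B^x_a}_{a∈𝒜} on H, x ∈ 𝒳, such that the symmetric strategy 𝒮′ = (|ψ⟩, B) satisfies δ_sync(𝒮′; ν) ≤ C₁ δ^{1/8} and E_{x∼ν} Σ_a Tr((A^x_a − B^x_a)² ρ) ≤ C₂ δ^{1/4}. -/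
open scoped Kronecker ComplexOrder
open Matrix MeasureTheory

attribute [local instance] Matrix.normedAddCommGroup Matrix.normedSpace

namespace AlmostSync

/-- Frobenius norm of a complex matrix. -/
noncomputable def frob {n : Type*} [Fintype n] (X : Matrix n n ℂ) : ℝ :=
  Real.sqrt ((Xᴴ * X).trace.re)

/-- `⟨ψ| M |ψ⟩` (real part). -/
noncomputable def ev {m : Type*} [Fintype m] (ψ : m → ℂ) (M : Matrix m m ℂ) : ℝ :=
  (star ψ ⬝ᵥ M.mulVec ψ).re

/-- Squared `ℓ²` norm of a vector. -/
noncomputable def nsq {m : Type*} [Fintype m] (v : m → ℂ) : ℝ :=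
  ∑ p, Complex.normSq (v p)

/-- A probability distribution on a finite set. -/
def IsDist {𝒳 : Type*} [Fintype 𝒳] (ν : 𝒳 → ℝ) : Prop :=
  (∀ x, 0 ≤ ν x) ∧ ∑ x, ν x = 1

/-- A POVM on a finite-dimensional space. -/
def IsPOVM {n 𝒜 : Type*} [Fintype n] [DecidableEq n] [Fintype 𝒜]
    (A : 𝒜 → Matrix n n ℂ) : Prop :=
  (∀ a, (A a).PosSemidef) ∧ ∑ a, A a = 1

/-- A projective measurement. -/
def IsProjMeas {n 𝒜 : Type*} [Fintype n] [DecidableEq n] [Fintype 𝒜]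
    (A : 𝒜 → Matrix n n ℂ) : Prop :=
  (∀ a, (A a)ᴴ = A a ∧ A a * A a = A a) ∧ ∑ a, A a = 1

/-- A projective measurement supported on the range of a projection `P`. -/
def IsProjMeasOn {n 𝒜 : Type*} [Fintype n] [DecidableEq n] [Fintype 𝒜]
    (P : Matrix n n ℂ) (A : 𝒜 → Matrix n n ℂ) : Prop :=
  (∀ a, (A a)ᴴ = A a ∧ A a * A a = A a ∧ P * A a = A a ∧ A a * P = A a) ∧ ∑ a, A a = P

/-- The state `Σ_i √(lam i) |i⟩|i⟩` (standard basis as eigenbasis). -/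
noncomputable def canonPsi {n : Type*} [DecidableEq n] (lam : n → ℝ) : n × n → ℂ :=
  fun p => if p.1 = p.2 then (Real.sqrt (lam p.1) : ℂ) else 0

/-- The maximally entangled state `d^{-1/2} Σ_i |i⟩|i⟩`. -/
noncomputable def mePsi (d : ℕ) : Fin d × Fin d → ℂ :=
  fun p => if p.1 = p.2 then ((Real.sqrt d)⁻¹ : ℂ) else 0

/-- Default to synchronicity `E_{x∼ν} Σ_{a≠b} ⟨ψ| A^x_a ⊗ B^x_b |ψ⟩`. -/
noncomputable def deltaSync {n₁ n₂ 𝒳 𝒜 : Type*} [Fintype n₁] [Fintype n₂]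
    [Fintype 𝒳] [Fintype 𝒜] [DecidableEq 𝒜]
    (ν : 𝒳 → ℝ) (ψ : n₁ × n₂ → ℂ)
    (A : 𝒳 → 𝒜 → Matrix n₁ n₁ ℂ) (B : 𝒳 → 𝒜 → Matrix n₂ n₂ ℂ) : ℝ :=
  ∑ x, ν x * ∑ a, ∑ b, if a = b then 0 else ev ψ (A x a ⊗ₖ B x b)

/-- The correlation induced by a strategy. -/
noncomputable def corr {n₁ n₂ 𝒳 𝒴 𝒜 ℬ : Type*} [Fintype n₁] [Fintype n₂]
    (ψ : n₁ × n₂ → ℂ) (A : 𝒳 → 𝒜 → Matrix n₁ n₁ ℂ) (B : 𝒴 → ℬ → Matrix n₂ n₂ ℂ)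
    (x : 𝒳) (y : 𝒴) (a : 𝒜) (b : ℬ) : ℝ :=
  ev ψ (A x a ⊗ₖ B y b)

/-- Success probability of a strategy in a nonlocal game. -/
noncomputable def winProb {n₁ n₂ 𝒳 𝒴 𝒜 ℬ : Type*} [Fintype n₁] [Fintype n₂]
    [Fintype 𝒳] [Fintype 𝒴] [Fintype 𝒜] [Fintype ℬ]
    (ν : 𝒳 × 𝒴 → ℝ) (D : 𝒳 → 𝒴 → 𝒜 → ℬ → Bool)
    (ψ : n₁ × n₂ → ℂ) (A : 𝒳 → 𝒜 → Matrix n₁ n₁ ℂ) (B : 𝒴 → ℬ → Matrix n₂ n₂ ℂ) : ℝ :=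
  ∑ x, ∑ y, ν (x, y) * ∑ a, ∑ b, (if D x y a b then (1:ℝ) else 0) * ev ψ (A x a ⊗ₖ B y b)

/-- Reduced density operator on the first tensor factor. -/
noncomputable def rhoA {n₁ n₂ : Type*} [Fintype n₂] (ψ : n₁ × n₂ → ℂ) : Matrix n₁ n₁ ℂ :=
  Matrix.of fun i i' => ∑ j, ψ (i, j) * star (ψ (i', j))

/-- Reduced density operator on the second tensor factor. -/
noncomputable def rhoB {n₁ n₂ : Type*} [Fintype n₁] (ψ : n₁ × n₂ → ℂ) : Matrix n₂ n₂ ℂ :=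
  Matrix.of fun j j' => ∑ i, ψ (i, j) * star (ψ (i, j'))

/-- Transpose with respect to the orthonormal basis given by the columns of a unitary `U`. -/
noncomputable def transposeB {n : Type*} [Fintype n] (U X : Matrix n n ℂ) : Matrix n n ℂ :=
  U * (Uᴴ * X * U)ᵀ * Uᴴ

/-- Canonical purification `Σ_k √(lam k) |u_k⟩|u_k⟩` of `U * diagonal lam * Uᴴ`,
where `u_k` is the `k`-th column of `U`. -/
noncomputable def purif {n : Type*} [Fintype n] (U : Matrix n n ℂ) (lam : n → ℝ) :
    n × n → ℂ :=
  fun p => ∑ k, (Real.sqrt (lam k) : ℂ) * U p.1 k * U p.2 k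

/-- Spectral projection of a Hermitian matrix onto eigenvalues `≥ t`
(the indicator of `[t, ∞)` applied via the functional calculus). -/
noncomputable def specProj {n : Type*} [Fintype n] [DecidableEq n] {M : Matrix n n ℂ}
    (hM : M.IsHermitian) (t : ℝ) : Matrix n n ℂ :=
  hM.cfc (fun x => if t ≤ x then 1 else 0)

/-- Spectral projection at level `t` of the diagonal matrix with entries `lam`. -/
noncomputable def Pdiag {n : Type*} [Fintype n] [DecidableEq n] (lam : n → ℝ) (t : ℝ) :
    Matrix n n ℂ :=
  Matrix.diagonal (fun i => if t ≤ lam i then 1 else 0)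

/-- `ψ` is the maximally entangled state on `H' ⊗ H'` where `H'` is the range of the
projection `P`. -/
def IsMaxEntOn {n : Type*} [Fintype n] [DecidableEq n] (ψ : n × n → ℂ)
    (P : Matrix n n ℂ) : Prop :=
  ∃ (S : Finset n) (v : n → n → ℂ),
    (∀ i ∈ S, ∀ j ∈ S, star (v i) ⬝ᵥ v j = if i = j then 1 else 0) ∧
    P = ∑ i ∈ S, Matrix.vecMulVec (v i) (star (v i)) ∧
    ψ = fun p => ((Real.sqrt S.card)⁻¹ : ℂ) * ∑ i ∈ S, v i p.1 * v i p.2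

lemma rhoA_isHermitian {n₁ n₂ : Type*} [Fintype n₂] (ψ : n₁ × n₂ → ℂ) :
    (rhoA ψ).IsHermitian := by
  refine Matrix.ext fun i j => ?_
  simp only [rhoA, Matrix.conjTranspose_apply, Matrix.of_apply, star_sum, star_mul',
    star_star]
  exact Finset.sum_congr rfl fun k _ => mul_comm _ _

lemma rhoB_isHermitian {n₁ n₂ : Type*} [Fintype n₁] (ψ : n₁ × n₂ → ℂ) :
    (rhoB ψ).IsHermitian := by
  refine Matrix.ext fun i j => ?_
  simp only [rhoB, Matrix.conjTranspose_apply, Matrix.of_apply, star_sum, star_mul',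
    star_star]
  exact Finset.sum_congr rfl fun k _ => mul_comm _ _


section HilbertSchmidt

variable {n : Type*} [Fintype n]

/-- Squared Hilbert–Schmidt norm. -/
noncomputable def hs (M : Matrix n n ℂ) : ℝ := (Mᴴ * M).trace.re

/-- The (unnormalised) state `M ↦ Re Tr(σ M σ)`. -/
noncomputable def st (σ M : Matrix n n ℂ) : ℝ := (σ * M * σ).trace.re

lemma hs_eq_sum (M : Matrix n n ℂ) : hs M = ∑ i, ∑ j, Complex.normSq (M i j) := by
  rw [Finset.sum_comm]
  simp [hs, Matrix.trace, Matrix.mul_apply, Complex.normSq_apply]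

lemma hs_nonneg (M : Matrix n n ℂ) : 0 ≤ hs M := by
  rw [hs_eq_sum]
  exact Finset.sum_nonneg fun i _ => Finset.sum_nonneg fun j _ => Complex.normSq_nonneg _

lemma hs_conjTranspose (M : Matrix n n ℂ) : hs Mᴴ = hs M := by
  simp [hs, Matrix.trace_mul_comm M]

lemma hs_neg (M : Matrix n n ℂ) : hs (-M) = hs M := by simp [hs]

lemma re_trace_conjTranspose_mul_comm (M N : Matrix n n ℂ) :
    (Nᴴ * M).trace.re = (Mᴴ * N).trace.re := by
  have h : (Nᴴ * M) = (Mᴴ * N)ᴴ := by simp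
  rw [h, Matrix.trace_conjTranspose]; simp

lemma hs_add (M N : Matrix n n ℂ) : hs (M + N) = hs M + hs N + 2 * (Mᴴ * N).trace.re := by
  have := re_trace_conjTranspose_mul_comm M N
  simp only [hs, Matrix.conjTranspose_add, Matrix.add_mul, Matrix.mul_add, Matrix.trace_add,
    Complex.add_re]
  linarith

lemma hs_sub (M N : Matrix n n ℂ) : hs (M - N) = hs M + hs N - 2 * (Mᴴ * N).trace.re := by
  rw [sub_eq_add_neg, hs_add, hs_neg]
  simp; ring

lemma two_re_trace_le (M N : Matrix n n ℂ) : 2 * (Mᴴ * N).trace.re ≤ hs M + hs N := by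
  have := hs_nonneg (M - N)
  rw [hs_sub] at this; linarith

lemma hs_add_add_le (M N K : Matrix n n ℂ) :
    hs (M + N + K) ≤ 3 * hs M + 3 * hs N + 3 * hs K := by
  have h1 := two_re_trace_le M N
  have h2 := two_re_trace_le M K
  have h3 := two_re_trace_le N K
  rw [hs_add, hs_add, Matrix.conjTranspose_add, Matrix.add_mul, Matrix.trace_add, Complex.add_re]
  linarith

lemma st_add (σ M N : Matrix n n ℂ) : st σ (M + N) = st σ M + st σ N := by
  simp [st, Matrix.mul_add, Matrix.add_mul]

lemma st_sub (σ M N : Matrix n n ℂ) : st σ (M - N) = st σ M - st σ N := by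
  simp [st, Matrix.mul_sub, Matrix.sub_mul]

lemma st_sum {ι : Type*} (s : Finset ι) (σ : Matrix n n ℂ) (M : ι → Matrix n n ℂ) :
    st σ (∑ i ∈ s, M i) = ∑ i ∈ s, st σ (M i) := by
  simp [st, Finset.mul_sum, Finset.sum_mul, Matrix.trace_sum]

lemma st_nonneg {σ M : Matrix n n ℂ} (hσ : σᴴ = σ) (hM : M.PosSemidef) : 0 ≤ st σ M := by
  have h := hM.conjTranspose_mul_mul_same σ
  rw [hσ] at h
  exact (Complex.le_def.1 h.trace_nonneg).1

lemma hs_mul_eq_st {σ : Matrix n n ℂ} (hσ : σᴴ = σ) (M : Matrix n n ℂ) :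
    hs (M * σ) = st σ (Mᴴ * M) := by
  simp [hs, st, hσ, Matrix.mul_assoc]

lemma sum_hs_mul {ι : Type*} (s : Finset ι) (C : ι → Matrix n n ℂ) (M : Matrix n n ℂ) :
    ∑ i ∈ s, hs (C i * M) = (Mᴴ * (∑ i ∈ s, (C i)ᴴ * C i) * M).trace.re := by
  simp [hs, Finset.mul_sum, Finset.sum_mul, Matrix.trace_sum, Matrix.mul_assoc]

variable [DecidableEq n]

lemma posSemidef_one_sub_of_proj {P : Matrix n n ℂ} (h1 : Pᴴ = P) (h2 : P * P = P) :
    (1 - P).PosSemidef := by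
  have h : 1 - P = (1 - P)ᴴ * (1 - P) := by
    simp [h1, Matrix.sub_mul, Matrix.mul_sub, h2]
  rw [h]; exact Matrix.posSemidef_conjTranspose_mul_self _

lemma hs_mul_le {C : Matrix n n ℂ} (hC : (1 - Cᴴ * C).PosSemidef) (M : Matrix n n ℂ) :
    hs (C * M) ≤ hs M := by
  have h := (Complex.le_def.1 (hC.conjTranspose_mul_mul_same M).trace_nonneg).1
  simp only [Matrix.mul_sub, Matrix.sub_mul, Matrix.mul_one, Matrix.trace_sub, Complex.sub_re,
    Complex.zero_re] at h
  simp only [hs, Matrix.conjTranspose_mul, Matrix.mul_assoc] at h ⊢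
  linarith

lemma hs_unitary_mul {C : Matrix n n ℂ} (hC : Cᴴ * C = 1) (M : Matrix n n ℂ) :
    hs (C * M) = hs M := by
  rw [hs, hs, Matrix.conjTranspose_mul, Matrix.mul_assoc, ← Matrix.mul_assoc Cᴴ, hC,
    Matrix.one_mul]

/-- If `0 ≤ N ≤ c` then `N² ≤ c N`. -/
lemma posSemidef_smul_sub_mul_self {N : Matrix n n ℂ} {c : ℝ} (hc : 0 < c)
    (hN : N.PosSemidef) (hNc : ((c : ℂ) • (1 : Matrix n n ℂ) - N).PosSemidef) :
    ((c : ℂ) • N - N * N).PosSemidef := by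
  set K := (c : ℂ) • (1 : Matrix n n ℂ) - N with hK
  have h1 := hN.conjTranspose_mul_mul_same K
  have h2 := hNc.conjTranspose_mul_mul_same N
  rw [hNc.1.eq] at h1
  rw [hN.1.eq] at h2
  have e : K * N * K + N * K * N = (c : ℂ) • ((c : ℂ) • N - N * N) := by
    simp only [hK, Matrix.sub_mul, Matrix.mul_sub, Matrix.smul_mul, Matrix.mul_smul,
      Matrix.one_mul, Matrix.mul_one, smul_sub, Matrix.mul_assoc]
    abel
  have h := (e ▸ h1.add h2).smul (a := ((c⁻¹ : ℝ) : ℂ)) (by exact_mod_cast (inv_pos.2 hc).le)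
  have hc0 : (c : ℂ) ≠ 0 := by exact_mod_cast hc.ne'
  rwa [smul_smul, Complex.ofReal_inv, inv_mul_cancel₀ hc0, one_smul] at h

lemma st_mul_self_le {σ N : Matrix n n ℂ} (hσ : σᴴ = σ) {c : ℝ} (hc : 0 < c)
    (hN : N.PosSemidef) (hNc : ((c : ℂ) • (1 : Matrix n n ℂ) - N).PosSemidef) :
    st σ (N * N) ≤ c * st σ N := by
  have h := st_nonneg hσ (posSemidef_smul_sub_mul_self hc hN hNc)
  have e : st σ ((c : ℂ) • N) = c * st σ N := by simp [st]
  rw [st_sub, e] at h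
  linarith

end HilbertSchmidt
section Diagonal

variable {n : Type*} [DecidableEq n]

/-- Diagonal matrix with real entries. -/
noncomputable def rdiag (d : n → ℝ) : Matrix n n ℂ := Matrix.diagonal fun i => (d i : ℂ)

lemma rdiag_conjTranspose (d : n → ℝ) : (rdiag d)ᴴ = rdiag d := by
  rw [rdiag, Matrix.diagonal_conjTranspose]
  congr 1; ext i; simp

lemma rdiag_sub (d e : n → ℝ) : rdiag d - rdiag e = rdiag fun i => d i - e i := by
  simp [rdiag]

lemma rdiag_one : rdiag (fun _ : n => (1 : ℝ)) = 1 := by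
  simp [rdiag]

variable [Fintype n]

lemma rdiag_mul (d e : n → ℝ) : rdiag d * rdiag e = rdiag fun i => d i * e i := by
  simp [rdiag]

lemma hs_rdiag_mul (d : n → ℝ) (M : Matrix n n ℂ) :
    hs (rdiag d * M) = ∑ i, d i ^ 2 * ∑ j, Complex.normSq (M i j) := by
  rw [hs_eq_sum]
  refine Finset.sum_congr rfl fun i _ => ?_
  rw [Finset.mul_sum]
  refine Finset.sum_congr rfl fun j _ => ?_
  rw [rdiag, Matrix.diagonal_mul, Complex.normSq_mul, Complex.normSq_ofReal]; ring

lemma exists_diagonalization {H : Matrix n n ℂ} (hH : H.IsHermitian) :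
    ∃ (U : Matrix n n ℂ) (d : n → ℝ), Uᴴ * U = 1 ∧ U * Uᴴ = 1 ∧ H = U * rdiag d * Uᴴ := by
  refine ⟨hH.eigenvectorUnitary, hH.eigenvalues, ?_, ?_, ?_⟩
  · exact Unitary.coe_star_mul_self hH.eigenvectorUnitary
  · exact Unitary.coe_mul_star_self hH.eigenvectorUnitary
  · have h := hH.spectral_theorem
    rw [Unitary.conjStarAlgAut_apply] at h
    exact h

lemma posSemidef_conj_rdiag (U : Matrix n n ℂ) {d : n → ℝ} (hd : ∀ i, 0 ≤ d i) :
    (U * rdiag d * Uᴴ).PosSemidef := by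
  refine Matrix.PosSemidef.mul_mul_conjTranspose_same ?_ U
  rw [rdiag, Matrix.posSemidef_diagonal_iff]
  intro i; exact_mod_cast hd i

lemma nonneg_of_posSemidef_conj_rdiag {U : Matrix n n ℂ} (hU : Uᴴ * U = 1) {d : n → ℝ}
    (h : (U * rdiag d * Uᴴ).PosSemidef) (i : n) : 0 ≤ d i := by
  have h1 := h.conjTranspose_mul_mul_same U
  have e : Uᴴ * (U * rdiag d * Uᴴ) * U = rdiag d := by
    rw [Matrix.mul_assoc, Matrix.mul_assoc, hU, Matrix.mul_one, ← Matrix.mul_assoc, hU,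
      Matrix.one_mul]
  rw [e, rdiag, Matrix.posSemidef_diagonal_iff] at h1
  exact_mod_cast h1 i

lemma conj_rdiag_mul {U : Matrix n n ℂ} (hU : Uᴴ * U = 1) (d e : n → ℝ) :
    (U * rdiag d * Uᴴ) * (U * rdiag e * Uᴴ) = U * rdiag (fun i => d i * e i) * Uᴴ := by
  rw [← rdiag_mul]
  calc _ = U * rdiag d * (Uᴴ * U) * rdiag e * Uᴴ := by simp only [Matrix.mul_assoc]
    _ = _ := by rw [hU]; simp only [Matrix.mul_assoc, Matrix.one_mul]

lemma conj_rdiag_sub (U : Matrix n n ℂ) (d e : n → ℝ) :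
    U * rdiag d * Uᴴ - U * rdiag e * Uᴴ = U * rdiag (fun i => d i - e i) * Uᴴ := by
  rw [← rdiag_sub, Matrix.mul_sub, Matrix.sub_mul]

lemma conj_rdiag_add (U : Matrix n n ℂ) (d e : n → ℝ) :
    U * rdiag d * Uᴴ + U * rdiag e * Uᴴ = U * rdiag (fun i => d i + e i) * Uᴴ := by
  rw [← Matrix.add_mul, ← Matrix.mul_add]
  simp [rdiag]

lemma conj_rdiag_conjTranspose (U : Matrix n n ℂ) (d : n → ℝ) :
    (U * rdiag d * Uᴴ)ᴴ = U * rdiag d * Uᴴ := by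
  simp [rdiag_conjTranspose, Matrix.mul_assoc]

lemma st_conj_rdiag {σ : Matrix n n ℂ} (hσ : σᴴ = σ) (U : Matrix n n ℂ) (d : n → ℝ) :
    st σ (U * rdiag d * Uᴴ) = ∑ k, d k * ∑ j, Complex.normSq ((Uᴴ * σ) k j) := by
  have h : (σ * (U * rdiag d * Uᴴ) * σ).trace = (rdiag d * ((Uᴴ * σ) * (Uᴴ * σ)ᴴ)).trace := by
    rw [Matrix.trace_mul_comm (rdiag d)]
    rw [Matrix.conjTranspose_mul, hσ, Matrix.conjTranspose_conjTranspose]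
    have : σ * (U * rdiag d * Uᴴ) * σ = (σ * U * rdiag d) * (Uᴴ * σ) := by
      simp only [Matrix.mul_assoc]
    rw [this, Matrix.trace_mul_comm]
    simp only [Matrix.mul_assoc]
  rw [st, h, Matrix.trace, Complex.re_sum]
  refine Finset.sum_congr rfl fun k _ => ?_
  rw [Matrix.diag_apply, rdiag, Matrix.diagonal_mul, Complex.re_ofReal_mul, Matrix.mul_apply,
    Complex.re_sum]
  congr 1
  refine Finset.sum_congr rfl fun j _ => ?_
  rw [Matrix.conjTranspose_apply]
  simp [Complex.normSq_apply]

/-- Quantitative polar decomposition: `X` is as close to a unitary as `Xᴴ X` is to `1`. -/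
lemma exists_unitary_close (X σ : Matrix n n ℂ) :
    ∃ W : Matrix n n ℂ, Wᴴ * W = 1 ∧ W * Wᴴ = 1 ∧
      hs ((X - W) * σ) ≤ hs ((Xᴴ * X - 1) * σ) := by
  obtain ⟨V, μ, hV1, hV2, hX⟩ :=
    exists_diagonalization (Matrix.posSemidef_conjTranspose_mul_self X).1
  have hμ : ∀ i, 0 ≤ μ i := by
    refine nonneg_of_posSemidef_conj_rdiag hV1 ?_
    rw [← hX]; exact Matrix.posSemidef_conjTranspose_mul_self X
  have hcol : (X * V)ᴴ * (X * V) = rdiag μ := by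
    calc (X * V)ᴴ * (X * V) = Vᴴ * (Xᴴ * X) * V := by
          simp only [Matrix.conjTranspose_mul, Matrix.mul_assoc]
      _ = (Vᴴ * V) * rdiag μ * (Vᴴ * V) := by rw [hX]; simp only [Matrix.mul_assoc]
      _ = rdiag μ := by rw [hV1]; simp
  have hcol' : ∀ k l, ∑ i, star ((X * V) i k) * (X * V) i l = if k = l then (μ k : ℂ) else 0 := by
    intro k l
    have := congrFun (congrFun hcol k) l
    rw [Matrix.mul_apply, rdiag, Matrix.diagonal_apply] at this
    simpa using this
  let v : n → EuclideanSpace ℂ n := fun k =>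
    WithLp.toLp 2 fun i => ((Real.sqrt (μ k))⁻¹ : ℂ) * (X * V) i k
  let s : Set n := {k | μ k ≠ 0}
  have hv : Orthonormal ℂ (s.domRestrict v) := by
    rw [orthonormal_iff_ite]
    rintro ⟨k, hk⟩ ⟨l, hl⟩
    have hk' : μ k ≠ 0 := hk
    have hs0 : (Real.sqrt (μ k) : ℂ) ≠ 0 := by
      exact_mod_cast (Real.sqrt_pos.2 (lt_of_le_of_ne (hμ k) hk'.symm)).ne'
    have hss : (Real.sqrt (μ k) : ℂ) * Real.sqrt (μ k) = μ k := by
      exact_mod_cast Real.mul_self_sqrt (hμ k)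
    have e : inner ℂ (v k) (v l) = ((Real.sqrt (μ k))⁻¹ : ℂ) * ((Real.sqrt (μ l))⁻¹ : ℂ) *
        ∑ i, star ((X * V) i k) * (X * V) i l := by
      rw [Finset.mul_sum]
      simp only [v, PiLp.inner_apply]
      refine Finset.sum_congr rfl fun i _ => ?_
      simp
      ring
    change inner ℂ (v k) (v l) = _
    rw [e, hcol']
    by_cases hkl : k = l
    · subst hkl
      simp only [if_true]
      rw [← hss]; field_simp
    · simp [hkl]
  obtain ⟨b, hb⟩ := hv.exists_orthonormalBasis_extension_of_card_eq (by simp)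
  let Z : Matrix n n ℂ := Matrix.of fun i k => b k i
  have hZ : Zᴴ * Z = 1 := by
    ext k l
    have := orthonormal_iff_ite.1 b.orthonormal k l
    rw [PiLp.inner_apply] at this
    rw [Matrix.mul_apply, Matrix.one_apply, ← this]
    refine Finset.sum_congr rfl fun i _ => ?_
    simp [Z, mul_comm]
  have hXV : X * V = Z * rdiag fun k => Real.sqrt (μ k) := by
    ext i k
    rw [rdiag, Matrix.mul_diagonal]
    by_cases hk : μ k = 0
    · have h0 := hcol' k k
      simp only [if_true, hk, Complex.ofReal_zero] at h0
      have h1 : ∑ i, Complex.normSq ((X * V) i k) = 0 := by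
        have : ((∑ i, Complex.normSq ((X * V) i k) : ℝ) : ℂ) = 0 := by
          rw [← h0]; push_cast
          exact Finset.sum_congr rfl fun i _ => Complex.normSq_eq_conj_mul_self
        exact_mod_cast this
      have h2 := (Finset.sum_eq_zero_iff_of_nonneg
        (fun i _ => Complex.normSq_nonneg ((X * V) i k))).1 h1 i (Finset.mem_univ i)
      rw [Complex.normSq_eq_zero.1 h2, hk]; simp
    · have hs0 : (Real.sqrt (μ k) : ℂ) ≠ 0 := by
        exact_mod_cast (Real.sqrt_pos.2 (lt_of_le_of_ne (hμ k) (Ne.symm hk))).ne'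
      have : b k i = ((Real.sqrt (μ k))⁻¹ : ℂ) * (X * V) i k := by rw [hb k hk]
      simp only [Z, Matrix.of_apply, this]
      field_simp
  have hXd : X = Z * (rdiag fun k => Real.sqrt (μ k)) * Vᴴ := by
    rw [← hXV, Matrix.mul_assoc, hV2, Matrix.mul_one]
  have hW1 : (Z * Vᴴ)ᴴ * (Z * Vᴴ) = 1 := by
    rw [Matrix.conjTranspose_mul, Matrix.conjTranspose_conjTranspose, Matrix.mul_assoc,
      ← Matrix.mul_assoc Zᴴ, hZ, Matrix.one_mul, hV2]
  refine ⟨Z * Vᴴ, hW1, mul_eq_one_comm.1 hW1, ?_⟩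
  have e1 : (X - Z * Vᴴ) * σ = Z * (rdiag (fun k => Real.sqrt (μ k) - 1) * (Vᴴ * σ)) := by
    rw [← rdiag_sub, rdiag_one]
    conv_lhs => rw [hXd]
    simp only [Matrix.sub_mul, Matrix.mul_sub, Matrix.mul_assoc, Matrix.one_mul]
  have e2 : (Xᴴ * X - 1) * σ = V * (rdiag (fun k => μ k - 1) * (Vᴴ * σ)) := by
    have h1 : V * (Vᴴ * σ) = σ := by rw [← Matrix.mul_assoc, hV2, Matrix.one_mul]
    rw [← rdiag_sub, rdiag_one, hX]
    simp only [Matrix.sub_mul, Matrix.mul_sub, Matrix.mul_assoc, Matrix.one_mul, h1]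
  rw [e1, e2, hs_unitary_mul hZ, hs_unitary_mul hV1, hs_rdiag_mul, hs_rdiag_mul]
  refine Finset.sum_le_sum fun k _ => mul_le_mul_of_nonneg_right ?_
    (Finset.sum_nonneg fun j _ => Complex.normSq_nonneg _)
  have h1 := Real.sq_sqrt (hμ k)
  have h2 := Real.sqrt_nonneg (μ k)
  have h3 : μ k - 1 = (Real.sqrt (μ k) - 1) * (Real.sqrt (μ k) + 1) := by nlinarith
  rw [h3, mul_pow]
  nlinarith [sq_nonneg (Real.sqrt (μ k) - 1)]

end Diagonal
section Selection

/-- Rounding fractional weights of integral total mass to a set without decreasing a linear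
objective. -/
lemma exists_card_eq_sum_mul_le {ι : Type*} [Fintype ι] [DecidableEq ι] (θ c : ι → ℝ) (k : ℕ)
    (h0 : ∀ i, 0 ≤ θ i) (h1 : ∀ i, θ i ≤ 1) (hk : ∑ i, θ i = k) :
    ∃ T : Finset ι, T.card = k ∧ ∑ i, θ i * c i ≤ ∑ i ∈ T, c i := by
  have hcard : k ≤ Fintype.card ι := by
    have : (k : ℝ) ≤ Fintype.card ι := by
      rw [← hk]
      calc ∑ i, θ i ≤ ∑ _i : ι, (1 : ℝ) := Finset.sum_le_sum fun i _ => h1 i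
        _ = _ := by simp
    exact_mod_cast this
  have hne : (Finset.powersetCard k (Finset.univ : Finset ι)).Nonempty :=
    Finset.powersetCard_nonempty.2 (by simpa using hcard)
  obtain ⟨T, hT, hmax⟩ := Finset.exists_max_image _ (fun T => ∑ i ∈ T, c i) hne
  have hTk : T.card = k := (Finset.mem_powersetCard.1 hT).2
  refine ⟨T, hTk, ?_⟩
  have hswap : ∀ i ∈ T, ∀ j ∉ T, c j ≤ c i := by
    intro i hi j hj
    have hj' : j ∉ T.erase i := fun h => hj (Finset.mem_of_mem_erase h)
    have hm : insert j (T.erase i) ∈ Finset.powersetCard k (Finset.univ : Finset ι) := by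
      refine Finset.mem_powersetCard.2 ⟨Finset.subset_univ _, ?_⟩
      rw [Finset.card_insert_of_notMem hj', Finset.card_erase_add_one hi, hTk]
    have h := hmax _ hm
    rw [Finset.sum_insert hj'] at h
    have := Finset.add_sum_erase T c hi
    linarith
  rcases T.eq_empty_or_nonempty with hTe | hTne
  · have hk0 : ∑ i, θ i = 0 := by rw [hk, ← hTk, hTe]; simp
    have hz := (Finset.sum_eq_zero_iff_of_nonneg (fun i _ => h0 i)).1 hk0
    simp only [hTe, Finset.sum_empty]
    exact (Finset.sum_eq_zero fun i hi => by rw [hz i hi, zero_mul]).le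
  · obtain ⟨i₀, hi₀, hmin⟩ := Finset.exists_min_image T c hTne
    have hpt : ∀ i, θ i * (c i - c i₀) ≤ if i ∈ T then c i - c i₀ else 0 := by
      intro i
      split_ifs with hi
      · nlinarith [hmin i hi, h1 i]
      · nlinarith [hswap i₀ hi₀ i hi, h0 i]
    have h := Finset.sum_le_sum fun i (_ : i ∈ Finset.univ) => hpt i
    rw [← Finset.sum_filter, Finset.filter_univ_mem, Finset.sum_sub_distrib, Finset.sum_const,
      hTk, nsmul_eq_mul] at h
    simp only [mul_sub, Finset.sum_sub_distrib, ← Finset.sum_mul, hk] at h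
    linarith

variable {n 𝒜 : Type*} [DecidableEq n] [DecidableEq 𝒜]

/-- Diagonal projection onto the coordinates labelled `a`. -/
noncomputable def labelProj (f : n → 𝒜) (a : 𝒜) : Matrix n n ℂ :=
  rdiag fun k => if f k = a then 1 else 0

lemma labelProj_conjTranspose (f : n → 𝒜) (a : 𝒜) : (labelProj f a)ᴴ = labelProj f a :=
  rdiag_conjTranspose _

lemma labelProj_mul_self [Fintype n] (f : n → 𝒜) (a : 𝒜) :
    labelProj f a * labelProj f a = labelProj f a := by
  rw [labelProj, rdiag_mul]; congr 1; ext k; split_ifs <;> simp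

lemma sum_labelProj [Fintype 𝒜] (f : n → 𝒜) : ∑ a, labelProj f a = 1 := by
  ext i j
  simp only [labelProj, rdiag, Matrix.sum_apply, Matrix.diagonal_apply, Matrix.one_apply]
  by_cases h : i = j <;> simp [h, apply_ite Complex.ofReal]

variable [Fintype n] [Fintype 𝒜]

lemma IsPOVM.posSemidef_one_sub {A : 𝒜 → Matrix n n ℂ} (hA : IsPOVM A) (a : 𝒜) :
    (1 - A a).PosSemidef := by
  rw [← hA.2, ← Finset.add_sum_erase _ _ (Finset.mem_univ a), add_sub_cancel_left]
  exact Matrix.posSemidef_sum _ fun b _ => hA.1 b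

/-- Rounding a POVM to projections `Q a = (E_a X)ᴴ (E_a X)` of total rank at most the dimension. -/
lemma exists_proj_rounding {A : 𝒜 → Matrix n n ℂ} (hA : IsPOVM A) {σ : Matrix n n ℂ}
    (hσ : σᴴ = σ) :
    ∃ (X : Matrix n n ℂ) (f : n → 𝒜) (Q : 𝒜 → Matrix n n ℂ),
      (∀ a, Q a = (labelProj f a * X)ᴴ * (labelProj f a * X)) ∧
      (∀ a, Q a * Q a = Q a) ∧
      (∀ a, ((A a - A a * A a) + (A a - A a * A a) + (A a - Q a)).PosSemidef) ∧
      ∑ a, hs ((A a - Q a) * σ) ≤ ∑ a, st σ (A a) - ∑ a, st σ (A a * A a) ∧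
      2 * ∑ a, st σ (A a * A a) - ∑ a, st σ (A a) ≤ ∑ a, st σ (Q a) := by
  choose U d hU1 hU2 hAd using fun a => exists_diagonalization (hA.1 a).1
  have hd0 : ∀ a k, 0 ≤ d a k := fun a =>
    nonneg_of_posSemidef_conj_rdiag (hU1 a) (hAd a ▸ hA.1 a)
  have hd1 : ∀ a k, d a k ≤ 1 := by
    intro a k
    have h := hA.posSemidef_one_sub a
    have e : 1 - A a = U a * rdiag (fun k => 1 - d a k) * (U a)ᴴ := by
      rw [← conj_rdiag_sub, rdiag_one, Matrix.mul_one, hU2, ← hAd]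
    rw [e] at h
    linarith [nonneg_of_posSemidef_conj_rdiag (hU1 a) h k]
  have hsum : ∑ p : 𝒜 × n, d p.1 p.2 = (Fintype.card n : ℕ) := by
    have h1 : ∀ a, (A a).trace = ((∑ k, d a k : ℝ) : ℂ) := by
      intro a
      conv_lhs => rw [hAd a]
      rw [Matrix.mul_assoc, Matrix.trace_mul_comm, Matrix.mul_assoc, hU1, Matrix.mul_one, rdiag,
        Matrix.trace_diagonal]
      push_cast; rfl
    have h2 := congrArg Matrix.trace hA.2
    rw [Matrix.trace_sum, Matrix.trace_one] at h2
    simp only [h1] at h2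
    rw [Fintype.sum_prod_type]
    exact_mod_cast h2
  let w : 𝒜 → n → ℝ := fun a k => ∑ j, Complex.normSq (((U a)ᴴ * σ) k j)
  have hw : ∀ a k, 0 ≤ w a k := fun a k => Finset.sum_nonneg fun j _ => Complex.normSq_nonneg _
  obtain ⟨T, hTcard, hT⟩ := exists_card_eq_sum_mul_le (fun p : 𝒜 × n => d p.1 p.2)
    (fun p => max (w p.1 p.2 * (2 * d p.1 p.2 - 1)) 0) (Fintype.card n)
    (fun p => hd0 _ _) (fun p => hd1 _ _) hsum
  let q : 𝒜 → n → ℝ := fun a k => if (a, k) ∈ T ∧ 1 / 2 ≤ d a k then 1 else 0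
  have hkey : ∑ a, ∑ k, d a k * (w a k * (2 * d a k - 1)) ≤
      ∑ a, ∑ k, q a k * (w a k * (2 * d a k - 1)) := by
    rw [← Fintype.sum_prod_type', ← Fintype.sum_prod_type']
    refine le_trans (Finset.sum_le_sum fun p _ =>
      mul_le_mul_of_nonneg_left (le_max_left _ 0) (hd0 _ _)) (hT.trans (le_of_eq ?_))
    rw [← Finset.filter_univ_mem T, Finset.sum_filter]
    refine Finset.sum_congr rfl fun p _ => ?_
    simp only [q]
    by_cases hp : p ∈ T
    · by_cases hd : 1 / 2 ≤ d p.1 p.2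
      · simp only [hp, hd, if_true, and_self, one_mul]
        exact max_eq_left (mul_nonneg (hw _ _) (by linarith))
      · simp only [hp, hd, if_true, and_false, if_false, zero_mul]
        exact max_eq_right (mul_nonpos_of_nonneg_of_nonpos (hw _ _) (by linarith))
    · simp [hp]
  have e : n ≃ T := Fintype.equivOfCardEq (by rw [Fintype.card_coe, hTcard])
  let X : Matrix n n ℂ := Matrix.of fun k j =>
    if 1 / 2 ≤ d (e k).1.1 (e k).1.2 then star (U (e k).1.1 j (e k).1.2) else 0
  let f : n → 𝒜 := fun k => (e k).1.1
  let Q : 𝒜 → Matrix n n ℂ := fun a => U a * rdiag (q a) * (U a)ᴴ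
  have hq : ∀ a k, q a k = 0 ∨ (q a k = 1 ∧ 1 / 2 ≤ d a k) := by
    intro a k
    by_cases h : (a, k) ∈ T ∧ 1 / 2 ≤ d a k
    · right; simp only [q, if_pos h]; exact ⟨trivial, h.2⟩
    · left; simp only [q, if_neg h]
  have hAA : ∀ a, A a * A a = U a * rdiag (fun k => d a k * d a k) * (U a)ᴴ := by
    intro a
    conv_lhs => rw [hAd a]
    exact conj_rdiag_mul (hU1 a) _ _
  have hst1 : ∀ a, st σ (A a) = ∑ k, d a k * w a k := by
    intro a
    conv_lhs => rw [hAd a]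
    exact st_conj_rdiag hσ _ _
  have hst2 : ∀ a, st σ (A a * A a) = ∑ k, d a k * d a k * w a k := by
    intro a
    rw [hAA]
    exact st_conj_rdiag hσ _ _
  have hst3 : ∀ a, st σ (Q a) = ∑ k, q a k * w a k := fun a => st_conj_rdiag hσ _ _
  have hst4 : ∀ a, hs ((A a - Q a) * σ) = ∑ k, (d a k - q a k) * (d a k - q a k) * w a k := by
    intro a
    have h : A a - Q a = U a * rdiag (fun k => d a k - q a k) * (U a)ᴴ := by
      conv_lhs => rw [hAd a]
      exact conj_rdiag_sub _ _ _
    rw [h, hs_mul_eq_st hσ, conj_rdiag_conjTranspose, conj_rdiag_mul (hU1 a)]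
    exact st_conj_rdiag hσ _ _
  refine ⟨X, f, Q, ?_, ?_, ?_, ?_, ?_⟩
  · intro a
    have h1 : (labelProj f a * X)ᴴ * (labelProj f a * X) = Xᴴ * (labelProj f a * X) := by
      rw [Matrix.conjTranspose_mul, labelProj_conjTranspose, Matrix.mul_assoc,
        ← Matrix.mul_assoc (labelProj f a), labelProj_mul_self]
    rw [h1]
    ext i j
    let F : 𝒜 × n → ℂ := fun p =>
      if p.1 = a then (if 1 / 2 ≤ d p.1 p.2 then U p.1 i p.2 * star (U p.1 j p.2) else 0) else 0
    have hR : (Xᴴ * (labelProj f a * X)) i j = ∑ k, F (e k).1 := by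
      rw [Matrix.mul_apply]
      refine Finset.sum_congr rfl fun k _ => ?_
      rw [labelProj, rdiag, Matrix.diagonal_mul, Matrix.conjTranspose_apply]
      simp only [X, F, f, Matrix.of_apply]
      split_ifs <;> simp
    have hL : (U a * rdiag (q a) * (U a)ᴴ) i j = ∑ k, if (a, k) ∈ T then F (a, k) else 0 := by
      rw [Matrix.mul_apply]
      refine Finset.sum_congr rfl fun k _ => ?_
      rw [rdiag, Matrix.mul_diagonal, Matrix.conjTranspose_apply]
      simp only [q, F]
      by_cases h1 : (a, k) ∈ T <;> by_cases h2 : 1 / 2 ≤ d a k <;> simp only [h1, h2] <;> simp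
    change (U a * rdiag (q a) * (U a)ᴴ) i j = _
    rw [hR, hL, e.sum_comp (fun p : T => F p.1), Finset.sum_coe_sort T F,
      ← Finset.filter_univ_mem T, Finset.sum_filter, Fintype.sum_prod_type]
    rw [Finset.sum_eq_single a]
    · simp
    · intro b _ hb
      refine Finset.sum_eq_zero fun k _ => ?_
      simp [F, hb]
    · simp
  · intro a
    rw [conj_rdiag_mul (hU1 a)]
    have : (fun k => q a k * q a k) = q a := by
      ext k; rcases hq a k with h | h
      · simp [h]
      · simp [h.1]
    rw [this]
  · intro a
    have h : (A a - A a * A a) + (A a - A a * A a) + (A a - Q a) = U a * rdiag (fun k =>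
        (d a k - d a k * d a k) + (d a k - d a k * d a k) + (d a k - q a k)) * (U a)ᴴ := by
      rw [hAA]
      conv_lhs => rw [hAd a]
      simp only [Q, conj_rdiag_sub, conj_rdiag_add]
    rw [h]
    refine posSemidef_conj_rdiag _ fun k => ?_
    have h0 := hd0 a k
    have h1 := hd1 a k
    rcases hq a k with h | h
    · rw [h]; nlinarith
    · rw [h.1]; nlinarith [h.2]
  · simp only [hst1, hst2, hst4, ← Finset.sum_sub_distrib]
    have h : ∑ a, ∑ k, (d a k - q a k) * (d a k - q a k) * w a k =
        ∑ a, ∑ k, (d a k * w a k - d a k * d a k * w a k) +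
        (∑ a, ∑ k, d a k * (w a k * (2 * d a k - 1)) -
          ∑ a, ∑ k, q a k * (w a k * (2 * d a k - 1))) := by
      simp only [← Finset.sum_sub_distrib, ← Finset.sum_add_distrib]
      refine Finset.sum_congr rfl fun a _ => Finset.sum_congr rfl fun k _ => ?_
      rcases hq a k with h | h
      · rw [h]; ring
      · rw [h.1]; ring
    linarith
  · simp only [hst1, hst2, hst3, Finset.mul_sum, ← Finset.sum_sub_distrib]
    have h1 : ∑ a, ∑ k, q a k * (w a k * (2 * d a k - 1)) ≤ ∑ a, ∑ k, q a k * w a k := by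
      refine Finset.sum_le_sum fun a _ => Finset.sum_le_sum fun k _ => ?_
      have := mul_le_mul_of_nonneg_left (hd1 a k) (hw a k)
      rcases hq a k with h | h
      · rw [h]; simp
      · rw [h.1]; linarith
    refine le_trans (le_of_eq ?_) (hkey.trans h1)
    refine Finset.sum_congr rfl fun a _ => Finset.sum_congr rfl fun k _ => ?_
    ring

end Selection
section Rounding

variable {n : Type*} [Fintype n]

lemma hs_mul_sub_mul {σ P Q : Matrix n n ℂ} (hσ : σᴴ = σ) (hP : Pᴴ = P) (hQ : Qᴴ = Q) :
    hs (P * σ - σ * Q) = st σ (P * P) + st σ (Q * Q) - 2 * (P * σ * Q * σ).trace.re := by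
  have h1 : hs (σ * Q) = st σ (Q * Q) := by
    rw [← hs_conjTranspose, Matrix.conjTranspose_mul, hσ, hQ, hs_mul_eq_st hσ, hQ]
  have h2 : ((P * σ)ᴴ * (σ * Q)).trace = (P * σ * Q * σ).trace := by
    rw [Matrix.conjTranspose_mul, hσ, hP, Matrix.mul_assoc, Matrix.trace_mul_comm]
    simp only [Matrix.mul_assoc]
  rw [hs_sub, h1, h2, hs_mul_eq_st hσ, hP]

variable [DecidableEq n]

/-- If `Q = Xᴴ X` is a projection almost commuting with `σ` and `X σ` is close to `W σ`, then
`Wᴴ W` and `Q` are almost intertwined by `σ`. -/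
lemma st_le_re_trace {σ X W : Matrix n n ℂ} (hσ : σᴴ = σ)
    (hQ : (Xᴴ * X) * (Xᴴ * X) = Xᴴ * X) :
    st σ (Wᴴ * W) - 3 / 2 * hs ((Xᴴ * X) * σ - σ * (Xᴴ * X)) - 2 * hs ((X - W) * σ) ≤
      ((Wᴴ * W) * σ * (Xᴴ * X) * σ).trace.re := by
  have hXQ : X * (Xᴴ * X) = X := by
    have h : (X - X * (Xᴴ * X))ᴴ * (X - X * (Xᴴ * X)) = 0 := by
      have : (X - X * (Xᴴ * X))ᴴ * (X - X * (Xᴴ * X)) =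
          Xᴴ * X - (Xᴴ * X) * (Xᴴ * X) - ((Xᴴ * X) * (Xᴴ * X) -
            ((Xᴴ * X) * (Xᴴ * X)) * (Xᴴ * X)) := by
        simp only [Matrix.conjTranspose_sub, Matrix.conjTranspose_mul,
          Matrix.conjTranspose_conjTranspose, Matrix.sub_mul, Matrix.mul_sub, Matrix.mul_assoc]
      rw [this, hQ, hQ]; simp
    exact (sub_eq_zero.1 (Matrix.conjTranspose_mul_self_eq_zero.1 h)).symm
  have hXX : (1 - Xᴴᴴ * Xᴴ).PosSemidef := by
    rw [Matrix.conjTranspose_conjTranspose]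
    refine posSemidef_one_sub_of_proj (by simp) ?_
    rw [Matrix.mul_assoc, ← Matrix.mul_assoc Xᴴ, ← Matrix.mul_assoc X, hXQ]
  set D := X - W with hD
  have hWX : W = X - D := by rw [hD]; abel
  set C := (Xᴴ * X) * σ - σ * (Xᴴ * X) with hC
  have hQh : (Xᴴ * X)ᴴ = Xᴴ * X := by simp
  have hCn : hs C = 2 * st σ (Xᴴ * X) - 2 * ((Xᴴ * X) * σ * (Xᴴ * X) * σ).trace.re := by
    rw [hC, hs_mul_sub_mul hσ hQh hQh, hQ]; ring
  have ha : hs (X * σ * Xᴴ) = ((Xᴴ * X) * σ * (Xᴴ * X) * σ).trace.re := by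
    rw [hs]
    have : (X * σ * Xᴴ)ᴴ * (X * σ * Xᴴ) = X * (σ * (Xᴴ * X) * σ * Xᴴ) := by
      simp only [Matrix.conjTranspose_mul, Matrix.conjTranspose_conjTranspose, hσ,
        Matrix.mul_assoc]
    rw [this, Matrix.trace_mul_comm]
    have : σ * (Xᴴ * X) * σ * Xᴴ * X = σ * ((Xᴴ * X) * σ * (Xᴴ * X)) := by
      simp only [Matrix.mul_assoc]
    rw [this, Matrix.trace_mul_comm]
  have hp : hs (X * σ * Xᴴ - X * σ * Dᴴ) = ((Wᴴ * W) * σ * (Xᴴ * X) * σ).trace.re := by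
    have h1 : X * σ * Xᴴ - X * σ * Dᴴ = X * σ * Wᴴ := by
      rw [← Matrix.mul_sub, ← Matrix.conjTranspose_sub, ← hWX]
    rw [h1, hs]
    have : (X * σ * Wᴴ)ᴴ * (X * σ * Wᴴ) = W * (σ * (Xᴴ * X) * σ * Wᴴ) := by
      simp only [Matrix.conjTranspose_mul, Matrix.conjTranspose_conjTranspose, hσ,
        Matrix.mul_assoc]
    rw [this, Matrix.trace_mul_comm]
    have : σ * (Xᴴ * X) * σ * Wᴴ * W = (σ * (Xᴴ * X) * σ) * (Wᴴ * W) := by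
      simp only [Matrix.mul_assoc]
    rw [this, Matrix.trace_mul_comm]
    simp only [Matrix.mul_assoc]
  have hcross : ((X * σ * Xᴴ)ᴴ * (X * σ * Dᴴ)).trace =
      (Cᴴ * (σ * Dᴴ * X)).trace + ((D * σ)ᴴ * (X * σ)).trace := by
    have h1 : (X * σ * Xᴴ)ᴴ * (X * σ * Dᴴ) = X * (σ * (Xᴴ * X) * σ * Dᴴ) := by
      simp only [Matrix.conjTranspose_mul, Matrix.conjTranspose_conjTranspose, hσ,
        Matrix.mul_assoc]
    have h2 : Cᴴ = σ * (Xᴴ * X) - (Xᴴ * X) * σ := by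
      rw [hC]
      simp only [Matrix.conjTranspose_sub, Matrix.conjTranspose_mul,
        Matrix.conjTranspose_conjTranspose, hσ, Matrix.mul_assoc]
    have h3 : σ * (Xᴴ * X) * σ * Dᴴ * X =
        Cᴴ * (σ * Dᴴ * X) + (Xᴴ * X) * (σ * σ * Dᴴ * X) := by
      rw [h2, Matrix.sub_mul]
      simp only [Matrix.mul_assoc]
      abel
    have h4 : ((Xᴴ * X) * (σ * σ * Dᴴ * X)).trace = ((D * σ)ᴴ * (X * σ)).trace := by
      rw [Matrix.trace_mul_comm]
      have : σ * σ * Dᴴ * X * (Xᴴ * X) = σ * (σ * Dᴴ * (X * (Xᴴ * X))) := by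
        simp only [Matrix.mul_assoc]
      rw [this, hXQ, Matrix.trace_mul_comm, Matrix.conjTranspose_mul, hσ]
      simp only [Matrix.mul_assoc]
    rw [h1, Matrix.trace_mul_comm, h3, Matrix.trace_add, h4]
  have hG : hs (σ * Dᴴ * X) ≤ hs (D * σ) := by
    rw [← hs_conjTranspose]
    have : (σ * Dᴴ * X)ᴴ = Xᴴ * (D * σ) := by
      simp only [Matrix.conjTranspose_mul, Matrix.conjTranspose_conjTranspose, hσ]
    rw [this]
    exact hs_mul_le hXX _
  have hW : st σ (Wᴴ * W) = st σ (Xᴴ * X) + hs (D * σ) - 2 * ((D * σ)ᴴ * (X * σ)).trace.re := by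
    rw [← hs_mul_eq_st hσ, ← hs_mul_eq_st hσ, re_trace_conjTranspose_mul_comm, ← hs_sub,
      ← Matrix.sub_mul, ← hWX]
  have hbd := two_re_trace_le C (σ * Dᴴ * X)
  have hb := hs_nonneg (X * σ * Dᴴ)
  rw [hs_sub, hcross, Complex.add_re, ha] at hp
  linarith

variable {𝒜 : Type*} [Fintype 𝒜] [DecidableEq 𝒜]

/-- Orthonormalization of a POVM that almost commutes with `σ`. -/
lemma exists_projMeas_close {A : 𝒜 → Matrix n n ℂ} (hA : IsPOVM A) {σ : Matrix n n ℂ}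
    (hσ : σᴴ = σ) (hσ1 : hs σ = 1) :
    ∃ B : 𝒜 → Matrix n n ℂ, IsProjMeas B ∧
      1 - ∑ a, (B a * σ * B a * σ).trace.re ≤
        1000 * (1 - ∑ a, (A a * σ * A a * σ).trace.re) ∧
      ∑ a, hs ((A a - B a) * σ) ≤ 1000 * (1 - ∑ a, (A a * σ * A a * σ).trace.re) := by
  set δ := 1 - ∑ a, (A a * σ * A a * σ).trace.re with hδ
  have hst1 : st σ 1 = 1 := by rw [← hσ1, hs, hσ, st, Matrix.mul_one]
  have hstA : ∑ a, st σ (A a) = 1 := by rw [← st_sum, hA.2, hst1]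
  have hAh : ∀ a, (A a)ᴴ = A a := fun a => (hA.1 a).1
  have hV : ∀ a, (A a - A a * A a).PosSemidef := by
    intro a
    have := posSemidef_smul_sub_mul_self one_pos (hA.1 a) (by simpa using hA.posSemidef_one_sub a)
    simpa using this
  have hA2le : ∑ a, st σ (A a * A a) ≤ 1 := by
    rw [← hstA]
    refine Finset.sum_le_sum fun a _ => ?_
    have := st_nonneg hσ (hV a)
    rw [st_sub] at this; linarith
  have hcommA : ∑ a, hs (A a * σ - σ * A a) = 2 * ∑ a, st σ (A a * A a) - 2 * (1 - δ) := by
    rw [hδ]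
    simp only [sub_sub_cancel, Finset.mul_sum, ← Finset.sum_sub_distrib]
    refine Finset.sum_congr rfl fun a _ => ?_
    rw [hs_mul_sub_mul hσ (hAh a) (hAh a)]; ring
  have hcommA0 : 0 ≤ ∑ a, hs (A a * σ - σ * A a) := Finset.sum_nonneg fun a _ => hs_nonneg _
  have hδ0 : 0 ≤ δ := by linarith
  obtain ⟨X, f, Q, hQX, hQQ, hN, hAQ, hstQ⟩ := exists_proj_rounding hA hσ
  have hQh : ∀ a, (Q a)ᴴ = Q a := fun a => by rw [hQX]; simp
  have hQpsd : ∀ a, (Q a).PosSemidef := fun a => by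
    rw [hQX]; exact Matrix.posSemidef_conjTranspose_mul_self _
  -- `X` is almost unitary on the state
  have hS : Xᴴ * X = ∑ a, Q a := by
    have h : ∀ a, Q a = Xᴴ * labelProj f a * X := by
      intro a
      rw [hQX, Matrix.conjTranspose_mul, labelProj_conjTranspose, Matrix.mul_assoc,
        ← Matrix.mul_assoc (labelProj f a), labelProj_mul_self, Matrix.mul_assoc]
    simp only [h, ← Finset.sum_mul, ← Finset.mul_sum, sum_labelProj, Matrix.mul_one]
  obtain ⟨W, hW1, hW2, hXW⟩ := exists_unitary_close X σ
  set V := ∑ a, (A a - A a * A a) with hVdef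
  have hVp : V.PosSemidef := Matrix.posSemidef_sum _ fun a _ => hV a
  have hV1 : V = 1 - ∑ a, A a * A a := by rw [hVdef, Finset.sum_sub_distrib, hA.2]
  have hA2p : (∑ a, A a * A a).PosSemidef := Matrix.posSemidef_sum _ fun a _ => by
    have := Matrix.posSemidef_conjTranspose_mul_self (A a)
    rwa [hAh] at this
  have hSp : (∑ a, Q a).PosSemidef := Matrix.posSemidef_sum _ fun a _ => hQpsd a
  set N := V + V + (1 - ∑ a, Q a) with hNdef
  have hNp : N.PosSemidef := by
    have h := Matrix.posSemidef_sum Finset.univ fun a _ => hN a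
    rwa [Finset.sum_add_distrib, Finset.sum_add_distrib, ← hVdef, Finset.sum_sub_distrib,
      hA.2] at h
  have hstV : st σ V = 1 - ∑ a, st σ (A a * A a) := by rw [hV1, st_sub, hst1, st_sum]
  have hstN : st σ N = 2 * st σ V + 1 - ∑ a, st σ (Q a) := by
    rw [hNdef, st_add, st_add, st_sub, hst1, st_sum Finset.univ σ Q]; ring
  have hVV : st σ (V * V) ≤ 1 * st σ V := by
    refine st_mul_self_le hσ one_pos hVp ?_
    rw [hV1]; simpa using hA2p
  have hNN : st σ (N * N) ≤ 3 * st σ N := by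
    refine st_mul_self_le hσ (by norm_num) hNp ?_
    have e : (((3 : ℝ) : ℂ) • (1 : Matrix n n ℂ) - N) =
        (∑ a, A a * A a) + (∑ a, A a * A a) + ∑ a, Q a := by
      have h3 : ((3 : ℝ) : ℂ) • (1 : Matrix n n ℂ) = 1 + 1 + 1 := by
        rw [show ((3 : ℝ) : ℂ) = 1 + 1 + 1 by norm_num, add_smul, add_smul, one_smul]
      rw [h3, hNdef, hV1]; abel
    rw [e]
    exact (hA2p.add hA2p).add hSp
  have hη : hs ((X - W) * σ) ≤ 42 * δ := by
    refine hXW.trans ?_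
    have e : (Xᴴ * X - 1) * σ = V * σ + V * σ + (-N) * σ := by
      rw [hS, ← Matrix.add_mul, ← Matrix.add_mul, hNdef]
      congr 1; abel
    rw [e]
    refine (hs_add_add_le _ _ _).trans ?_
    rw [Matrix.neg_mul, hs_neg, hs_mul_eq_st hσ, hs_mul_eq_st hσ, hVp.1.eq, hNp.1.eq]
    linarith
  -- the rounded measurement
  let B : 𝒜 → Matrix n n ℂ := fun a => (labelProj f a * W)ᴴ * (labelProj f a * W)
  have hBeq : ∀ a, B a = Wᴴ * labelProj f a * W := by
    intro a
    simp only [B]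
    rw [Matrix.conjTranspose_mul, labelProj_conjTranspose, Matrix.mul_assoc,
      ← Matrix.mul_assoc (labelProj f a), labelProj_mul_self, Matrix.mul_assoc]
  have hBh : ∀ a, (B a)ᴴ = B a := fun a => by simp [B]
  have hBB : ∀ a, B a * B a = B a := by
    intro a
    calc B a * B a = Wᴴ * labelProj f a * (W * Wᴴ) * labelProj f a * W := by
          rw [hBeq]; simp only [Matrix.mul_assoc]
      _ = Wᴴ * (labelProj f a * labelProj f a) * W := by
          rw [hW2, Matrix.mul_one]; simp only [Matrix.mul_assoc]
      _ = B a := by rw [labelProj_mul_self, hBeq]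
  have hB1 : ∑ a, B a = 1 := by
    simp only [hBeq, ← Finset.sum_mul, ← Finset.mul_sum, sum_labelProj, Matrix.mul_one, hW1]
  have hstB : ∑ a, st σ (B a) = 1 := by rw [← st_sum, hB1, hst1]
  have hD : ∑ a, hs ((labelProj f a * X - labelProj f a * W) * σ) = hs ((X - W) * σ) := by
    simp only [← Matrix.mul_sub, Matrix.mul_assoc]
    rw [sum_hs_mul]
    simp only [labelProj_conjTranspose, labelProj_mul_self, sum_labelProj, Matrix.mul_one, hs]
  have hσA : ∀ a, hs (σ * (A a - Q a)) = hs ((A a - Q a) * σ) := by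
    intro a
    rw [← hs_conjTranspose, Matrix.conjTranspose_mul, hσ, Matrix.conjTranspose_sub, hAh, hQh]
  have hcommQ : ∑ a, hs (Q a * σ - σ * Q a) ≤ 12 * δ := by
    have h : ∑ a, hs (Q a * σ - σ * Q a) ≤
        6 * ∑ a, hs ((A a - Q a) * σ) + 3 * ∑ a, hs (A a * σ - σ * A a) := by
      rw [Finset.mul_sum, Finset.mul_sum, ← Finset.sum_add_distrib]
      refine Finset.sum_le_sum fun a _ => ?_
      have e : Q a * σ - σ * Q a =
          -((A a - Q a) * σ) + (A a * σ - σ * A a) + σ * (A a - Q a) := by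
        rw [Matrix.sub_mul, Matrix.mul_sub]; abel
      have := hs_add_add_le (-((A a - Q a) * σ)) (A a * σ - σ * A a) (σ * (A a - Q a))
      rw [hs_neg, hσA] at this
      rw [e]; linarith
    linarith
  have hBQ : ∑ a, hs (B a * σ - σ * Q a) ≤ 206 * δ := by
    have h : ∑ a, hs (B a * σ - σ * Q a) ≤ ∑ a, st σ (Q a) - ∑ a, st σ (B a) +
        3 * ∑ a, hs (Q a * σ - σ * Q a) +
        4 * ∑ a, hs ((labelProj f a * X - labelProj f a * W) * σ) := by
      rw [Finset.mul_sum, Finset.mul_sum, ← Finset.sum_sub_distrib, ← Finset.sum_add_distrib,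
        ← Finset.sum_add_distrib]
      refine Finset.sum_le_sum fun a _ => ?_
      have h := st_le_re_trace (X := labelProj f a * X) (W := labelProj f a * W) hσ
        (by rw [← hQX, hQQ])
      rw [← hQX] at h
      change st σ (B a) - _ - _ ≤ (B a * σ * Q a * σ).trace.re at h
      rw [hs_mul_sub_mul hσ (hBh a) (hQh a), hBB, hQQ]
      linarith
    have hN0 := st_nonneg hσ hNp
    rw [hD, hstB] at h
    linarith
  have hQB : ∀ a, hs (σ * B a - Q a * σ) = hs (B a * σ - σ * Q a) := by
    intro a
    rw [← hs_conjTranspose]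
    simp only [Matrix.conjTranspose_sub, Matrix.conjTranspose_mul, hσ, hBh, hQh]
  refine ⟨B, ⟨fun a => ⟨hBh a, hBB a⟩, hB1⟩, ?_, ?_⟩
  · have h : ∑ a, hs (B a * σ - σ * B a) = 2 * (1 - ∑ a, (B a * σ * B a * σ).trace.re) := by
      rw [← hstB, mul_sub, Finset.mul_sum, Finset.mul_sum, ← Finset.sum_sub_distrib]
      refine Finset.sum_congr rfl fun a _ => ?_
      rw [hs_mul_sub_mul hσ (hBh a) (hBh a), hBB]; ring
    have h' : ∑ a, hs (B a * σ - σ * B a) ≤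
        6 * ∑ a, hs (B a * σ - σ * Q a) + 3 * ∑ a, hs (Q a * σ - σ * Q a) := by
      rw [Finset.mul_sum, Finset.mul_sum, ← Finset.sum_add_distrib]
      refine Finset.sum_le_sum fun a _ => ?_
      have e : B a * σ - σ * B a =
          (B a * σ - σ * Q a) + -(Q a * σ - σ * Q a) + -(σ * B a - Q a * σ) := by abel
      have := hs_add_add_le (B a * σ - σ * Q a) (-(Q a * σ - σ * Q a)) (-(σ * B a - Q a * σ))
      rw [hs_neg, hs_neg, hQB] at this
      rw [e]; linarith
    linarith
  · have h : ∑ a, hs ((A a - B a) * σ) ≤ 3 * ∑ a, hs ((A a - Q a) * σ) +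
        3 * ∑ a, hs (Q a * σ - σ * Q a) + 3 * ∑ a, hs (B a * σ - σ * Q a) := by
      rw [Finset.mul_sum, Finset.mul_sum, Finset.mul_sum, ← Finset.sum_add_distrib,
        ← Finset.sum_add_distrib]
      refine Finset.sum_le_sum fun a _ => ?_
      have e : (A a - B a) * σ =
          (A a - Q a) * σ + (Q a * σ - σ * Q a) + -(B a * σ - σ * Q a) := by
        rw [Matrix.sub_mul, Matrix.sub_mul]; abel
      have := hs_add_add_le ((A a - Q a) * σ) (Q a * σ - σ * Q a) (-(B a * σ - σ * Q a))
      rw [hs_neg] at this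
      rw [e]; linarith
    linarith

end Rounding
section Strategy

variable {n 𝒳 𝒜 : Type*} [Fintype n] [DecidableEq n] [Fintype 𝒳] [Fintype 𝒜] [DecidableEq 𝒜]

lemma ev_canonPsi (lam : n → ℝ) (M N : Matrix n n ℂ) :
    ev (canonPsi lam) (M ⊗ₖ Nᵀ) =
      (M * rdiag (fun i => Real.sqrt (lam i)) * N * rdiag (fun i => Real.sqrt (lam i))).trace.re := by
  rw [ev]
  congr 1
  simp only [dotProduct, Matrix.mulVec, Fintype.sum_prod_type, canonPsi, Pi.star_apply,
    Matrix.kroneckerMap_apply, Matrix.transpose_apply, Matrix.trace, Matrix.diag_apply, rdiag,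
    Matrix.mul_diagonal]
  refine Finset.sum_congr rfl fun i _ => ?_
  rw [Finset.sum_eq_single i (fun j _ hj => by simp [hj.symm]) (by simp), Matrix.mul_apply]
  simp only [if_true, Matrix.mul_diagonal]
  rw [Finset.mul_sum, Finset.sum_mul]
  refine Finset.sum_congr rfl fun j _ => ?_
  rw [Finset.sum_eq_single j (fun k _ hk => by simp [hk.symm]) (by simp)]
  simp
  ring

lemma sum_offdiag_ev_canonPsi {lam : n → ℝ} (hlam : ∀ i, 0 ≤ lam i) (hlam1 : ∑ i, lam i = 1)
    {B : 𝒜 → Matrix n n ℂ} (hB : ∑ a, B a = 1) :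
    (∑ a, ∑ b, if a = b then 0 else ev (canonPsi lam) (B a ⊗ₖ (B b)ᵀ)) =
      1 - ∑ a, (B a * rdiag (fun i => Real.sqrt (lam i)) * B a *
        rdiag (fun i => Real.sqrt (lam i))).trace.re := by
  set σ := rdiag (fun i => Real.sqrt (lam i)) with hσ
  have h1 : ∀ a b, (if a = b then 0 else ev (canonPsi lam) (B a ⊗ₖ (B b)ᵀ)) =
      (B a * σ * B b * σ).trace.re - if a = b then (B a * σ * B a * σ).trace.re else 0 := by
    intro a b
    rw [ev_canonPsi]
    by_cases h : a = b
    · subst h; simp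
    · simp [h, hσ]
  have h2 : ∑ a, ∑ b, (B a * σ * B b * σ).trace.re = 1 := by
    simp only [← Complex.re_sum, ← Matrix.trace_sum, ← Finset.sum_mul, ← Finset.mul_sum, hB,
      Matrix.mul_one, Matrix.one_mul]
    rw [hσ, rdiag_mul]
    simp only [Real.mul_self_sqrt (hlam _), rdiag, Matrix.trace_diagonal, Complex.re_sum,
      Complex.ofReal_re]
    exact hlam1
  simp only [h1, Finset.sum_sub_distrib, h2]
  simp

end Strategy

/-- Lemma `main-step`: any symmetric strategy is close to a projective
symmetric strategy: `δ_sync(𝒮′;ν) ≤ C₁ δ^{1/8}` and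
`E_{x∼ν} Σ_a Tr((A^x_a − B^x_a)² ρ) ≤ C₂ δ^{1/4}`. -/
theorem stmt15 :
    ∃ C₁ C₂ : ℝ, 0 < C₁ ∧ 0 < C₂ ∧
    ∀ (n : ℕ) (𝒳 𝒜 : Type) [Fintype 𝒳] [Fintype 𝒜] [DecidableEq 𝒜]
      (lam : Fin n → ℝ) (_hlam : ∀ i, 0 ≤ lam i) (_hlam1 : ∑ i, lam i = 1)
      (A : 𝒳 → 𝒜 → Matrix (Fin n) (Fin n) ℂ) (_hA : ∀ x, IsPOVM (A x))
      (ν : 𝒳 → ℝ) (_hν : IsDist ν)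
      (δ : ℝ) (_hδ : δ = deltaSync ν (canonPsi lam) A (fun x a => (A x a)ᵀ)),
      ∃ B : 𝒳 → 𝒜 → Matrix (Fin n) (Fin n) ℂ,
        (∀ x, IsProjMeas (B x)) ∧
        deltaSync ν (canonPsi lam) B (fun x a => (B x a)ᵀ) ≤ C₁ * δ ^ ((1:ℝ)/8) ∧
        ∑ x, ν x * ∑ a,
            (((A x a - B x a) * (A x a - B x a) *
              Matrix.diagonal (fun i => (lam i : ℂ))).trace).re
          ≤ C₂ * δ ^ ((1:ℝ)/4) := by
  refine ⟨1000, 1000, by norm_num, by norm_num, ?_⟩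
  intro n 𝒳 𝒜 _ _ _ lam hlam hlam1 A hA ν hν δ hδ
  set σ : Matrix (Fin n) (Fin n) ℂ := rdiag (fun i => Real.sqrt (lam i)) with hσdef
  have hσ : σᴴ = σ := rdiag_conjTranspose _
  have hσσ : σ * σ = Matrix.diagonal (fun i => (lam i : ℂ)) := by
    rw [hσdef, rdiag_mul]
    simp only [Real.mul_self_sqrt (hlam _)]
    rfl
  have hσ1 : hs σ = 1 := by
    rw [hs, hσ, hσσ, Matrix.trace_diagonal, Complex.re_sum]
    simpa using hlam1
  have hsync : ∀ B : 𝒳 → 𝒜 → Matrix (Fin n) (Fin n) ℂ, (∀ x, ∑ a, B x a = 1) →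
      deltaSync ν (canonPsi lam) B (fun x a => (B x a)ᵀ) =
        ∑ x, ν x * (1 - ∑ a, (B x a * σ * B x a * σ).trace.re) := by
    intro B hB
    rw [deltaSync]
    exact Finset.sum_congr rfl fun x _ => by rw [sum_offdiag_ev_canonPsi hlam hlam1 (hB x)]
  choose B hB1 hB2 hB3 using fun x => exists_projMeas_close (hA x) hσ hσ1
  rw [hsync A fun x => (hA x).2] at hδ
  have hδ0 : 0 ≤ δ := by
    rw [hδ]
    refine Finset.sum_nonneg fun x _ => mul_nonneg (hν.1 x) ?_
    have h := (Finset.sum_nonneg fun a _ => hs_nonneg ((A x a - B x a) * σ)).trans (hB3 x)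
    linarith
  have hδ1 : δ ≤ 1 := by
    rw [hδ]
    refine (Finset.sum_le_sum fun x _ => mul_le_of_le_one_right (hν.1 x) ?_).trans hν.2.le
    have : 0 ≤ ∑ a, (A x a * σ * A x a * σ).trace.re := by
      refine Finset.sum_nonneg fun a _ => ?_
      set τ : Matrix (Fin n) (Fin n) ℂ := rdiag (fun i => √(√(lam i)))
      have hτ : τᴴ = τ := rdiag_conjTranspose _
      have hττ : σ = τ * τ := by
        rw [rdiag_mul]
        simp only [Real.mul_self_sqrt (Real.sqrt_nonneg _)]
        exact hσdef
      have e : (A x a * σ * A x a * σ).trace = ((τ * A x a * τ)ᴴ * (τ * A x a * τ)).trace := by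
        have h : (τ * A x a * τ)ᴴ * (τ * A x a * τ) = τ * (A x a * σ * A x a * τ) := by
          rw [hττ]
          simp only [Matrix.conjTranspose_mul, hτ, ((hA x).1 a).1.eq, Matrix.mul_assoc]
        rw [h, Matrix.trace_mul_comm τ, hττ]
        simp only [Matrix.mul_assoc]
      rw [e]
      exact hs_nonneg _
    linarith
  have hpow : ∀ p : ℝ, p ≤ 1 → δ ≤ δ ^ p := by
    intro p hp
    rcases hδ0.eq_or_lt with h | h
    · rw [← h]; exact Real.rpow_nonneg le_rfl _
    · simpa using Real.rpow_le_rpow_of_exponent_ge h hδ1 hp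
  have hmean : ∀ F : 𝒳 → ℝ,
      (∀ x, F x ≤ 1000 * (1 - ∑ a, (A x a * σ * A x a * σ).trace.re)) →
      ∑ x, ν x * F x ≤ 1000 * δ := by
    intro F hF
    rw [hδ, Finset.mul_sum]
    refine Finset.sum_le_sum fun x _ => ?_
    have := mul_le_mul_of_nonneg_left (hF x) (hν.1 x)
    linarith
  refine ⟨B, hB1, ?_, ?_⟩
  · rw [hsync B fun x => (hB1 x).2]
    refine (hmean _ hB2).trans ?_
    linarith [hpow (1 / 8) (by norm_num)]
  · refine (hmean _ fun x => ?_).trans (by linarith [hpow (1 / 4) (by norm_num)])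
    refine le_trans (le_of_eq (Finset.sum_congr rfl fun a _ => ?_)) (hB3 x)
    have hD : (A x a - B x a)ᴴ = A x a - B x a := by
      rw [Matrix.conjTranspose_sub, ((hA x).1 a).1, ((hB1 x).1 a).1]
    rw [hs_mul_eq_st hσ, hD, st, Matrix.mul_assoc σ, Matrix.trace_mul_comm σ,
      Matrix.mul_assoc _ σ σ, hσσ]

end AlmostSync
end

section
/- Let 𝒮′ = (|ψ⟩, B) be a symmetric projective strategy with question set 𝒳 and answer set 𝒜, let ν be a distribution on 𝒳, and let δ′ = δ_sync(𝒮′; ν). Let ρ be the reduced density of |ψ⟩ on H and for λ ∈ ℝ_+ let P_λ = χ_{≥λ}(ρ) be the spectral projection of ρ onto eigenvalues ≥ λ. Then ∫_0^∞ E_{x∼ν} Σ_a ‖B^x_a P_λ − P_λ B^x_a‖_F² dλ ≤ 2√(2δ′), where the integral is with respect to Lebesgue measure. -/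
open scoped Kronecker ComplexOrder
open Matrix MeasureTheory

attribute [local instance] Matrix.normedAddCommGroup Matrix.normedSpace

namespace AlmostSync

lemma frob_sq {n : Type*} [Fintype n] (X : Matrix n n ℂ) :
    frob X ^ 2 = ∑ i, ∑ j, Complex.normSq (X i j) := by
  have h : (Xᴴ * X).trace.re = ∑ i, ∑ j, Complex.normSq (X i j) := by
    rw [Finset.sum_comm]
    simp [Matrix.trace, Matrix.mul_apply, Complex.normSq_apply]
  rw [frob, h, Real.sq_sqrt]
  exact Finset.sum_nonneg fun i _ => Finset.sum_nonneg fun j _ => Complex.normSq_nonneg _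

lemma frob_commutator_Pdiag_sq {n : Type*} [Fintype n] [DecidableEq n] (lam : n → ℝ)
    (X : Matrix n n ℂ) (t : ℝ) :
    frob (X * Pdiag lam t - Pdiag lam t * X) ^ 2 =
      ∑ i, ∑ j, Complex.normSq (X i j) *
        (Set.Ioc (min (lam i) (lam j)) (max (lam i) (lam j))).indicator 1 t := by
  rw [frob_sq]
  refine Finset.sum_congr rfl fun i _ => Finset.sum_congr rfl fun j _ => ?_
  rw [Matrix.sub_apply, Pdiag, Matrix.mul_diagonal, Matrix.diagonal_mul]
  by_cases hi : t ≤ lam i <;> by_cases hj : t ≤ lam j <;>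
    simp [hi, hj, not_lt.mpr, lt_of_not_ge]

lemma integrable_indicator_Ioc (a b : ℝ) :
    Integrable ((Set.Ioc a b).indicator (1 : ℝ → ℝ)) (volume.restrict (Set.Ioi 0)) :=
  ((integrable_indicator_iff measurableSet_Ioc).2
    (integrableOn_const (by simp) (by simp))).integrableOn

lemma setIntegral_indicator_Ioc_min_max {a b : ℝ} (ha : 0 ≤ a) (hb : 0 ≤ b) :
    ∫ t in Set.Ioi (0 : ℝ), (Set.Ioc (min a b) (max a b)).indicator (1 : ℝ → ℝ) t
      = |a - b| := by
  have hsub : Set.Ioc (min a b) (max a b) ⊆ Set.Ioi 0 :=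
    fun t ht => (le_min ha hb).trans_lt ht.1
  rw [setIntegral_indicator measurableSet_Ioc, Set.inter_eq_self_of_subset_right hsub]
  simp [max_sub_min_eq_abs, abs_sub_comm]

lemma ev_canonPsi_kronecker {n : Type*} [Fintype n] [DecidableEq n] (lam : n → ℝ)
    (X Y : Matrix n n ℂ) :
    ev (canonPsi lam) (X ⊗ₖ Yᵀ) =
      ∑ i, ∑ j, Real.sqrt (lam i) * Real.sqrt (lam j) * (X i j * Y j i).re := by
  simp only [ev, canonPsi, dotProduct, Matrix.mulVec, Fintype.sum_prod_type,
    Matrix.kroneckerMap_apply, Matrix.transpose_apply, Pi.star_apply]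
  simp only [mul_ite, mul_zero, Finset.sum_ite_eq, Finset.mem_univ, if_true, apply_ite star,
    star_zero, ite_mul, zero_mul, Complex.re_sum]
  refine Finset.sum_congr rfl fun i _ => ?_
  rw [Finset.mul_sum, Complex.re_sum]
  refine Finset.sum_congr rfl fun j _ => ?_
  rw [Complex.star_def, Complex.conj_ofReal, Complex.re_ofReal_mul, Complex.re_mul_ofReal]
  ring

section Weight

variable {n 𝒳 𝒜 : Type*} [Fintype 𝒳] [Fintype 𝒜]

/-- Averaged squared modulus of the `(i, j)` entries of a family of measurements. -/
noncomputable def entryWeight (ν : 𝒳 → ℝ) (B : 𝒳 → 𝒜 → Matrix n n ℂ) (i j : n) : ℝ :=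
  ∑ x, ν x * ∑ a, Complex.normSq (B x a i j)

lemma entryWeight_nonneg {ν : 𝒳 → ℝ} (hν : IsDist ν) (B : 𝒳 → 𝒜 → Matrix n n ℂ) (i j : n) :
    0 ≤ entryWeight ν B i j :=
  Finset.sum_nonneg fun x _ => mul_nonneg (hν.1 x)
    (Finset.sum_nonneg fun _ _ => Complex.normSq_nonneg _)

variable [Fintype n] [DecidableEq n]

lemma IsProjMeas.mul_entry_symm {A : 𝒜 → Matrix n n ℂ} (hA : IsProjMeas A) (a : 𝒜) (i j : n) :
    A a i j * A a j i = Complex.normSq (A a i j) := by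
  rw [← Complex.mul_conj]
  congr 1
  exact (congrFun (congrFun (hA.1 a).1 j) i).symm

lemma entryWeight_comm {B : 𝒳 → 𝒜 → Matrix n n ℂ} (hB : ∀ x, IsProjMeas (B x))
    (ν : 𝒳 → ℝ) (i j : n) : entryWeight ν B i j = entryWeight ν B j i := by
  refine Finset.sum_congr rfl fun x _ => congrArg _ (Finset.sum_congr rfl fun a _ => ?_)
  have h := (hB x).mul_entry_symm a i j
  rw [mul_comm, (hB x).mul_entry_symm a j i] at h
  exact_mod_cast h.symm

lemma sum_entryWeight {B : 𝒳 → 𝒜 → Matrix n n ℂ} (hB : ∀ x, IsProjMeas (B x))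
    {ν : 𝒳 → ℝ} (hν : IsDist ν) (i : n) : ∑ j, entryWeight ν B i j = 1 := by
  have key (x : 𝒳) : ∑ j, ∑ a, Complex.normSq (B x a i j) = 1 := by
    have h : (∑ j, ∑ a, (Complex.normSq (B x a i j) : ℂ)) = 1 := by
      simp_rw [← (hB x).mul_entry_symm]
      rw [Finset.sum_comm]
      simp_rw [← Matrix.mul_apply, ((hB x).1 _).2]
      rw [← Matrix.sum_apply, (hB x).2, Matrix.one_apply_eq]
    exact_mod_cast h
  simp_rw [entryWeight]
  rw [Finset.sum_comm]
  simp_rw [← Finset.mul_sum, key, mul_one, hν.2]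

lemma deltaSync_canonPsi_transpose [DecidableEq 𝒜] {lam : n → ℝ} (hlam : ∀ i, 0 ≤ lam i)
    (hlam1 : ∑ i, lam i = 1) {B : 𝒳 → 𝒜 → Matrix n n ℂ} (hB : ∀ x, IsProjMeas (B x))
    {ν : 𝒳 → ℝ} (hν : IsDist ν) :
    deltaSync ν (canonPsi lam) B (fun x a => (B x a)ᵀ) =
      1 - ∑ i, ∑ j, entryWeight ν B i j * (Real.sqrt (lam i) * Real.sqrt (lam j)) := by
  have htot (x : 𝒳) : ∑ a, ∑ b, ev (canonPsi lam) (B x a ⊗ₖ (B x b)ᵀ) = 1 := by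
    have h : ∑ a, ∑ b, ev (canonPsi lam) (B x a ⊗ₖ (B x b)ᵀ) =
        ev (canonPsi lam) ((∑ a, B x a) ⊗ₖ (∑ b, B x b)ᵀ) := by
      simp only [ev_canonPsi_kronecker, Matrix.sum_apply, Finset.sum_mul]
      simp only [Finset.mul_sum, Complex.re_sum]
      rw [Finset.sum_congr rfl fun a _ => Finset.sum_comm, Finset.sum_comm]
      refine Finset.sum_congr rfl fun i _ => ?_
      rw [Finset.sum_congr rfl fun a _ => Finset.sum_comm, Finset.sum_comm]
    rw [h, (hB x).2, ev_canonPsi_kronecker, ← hlam1]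
    refine Finset.sum_congr rfl fun i _ => ?_
    rw [Finset.sum_eq_single i (fun j _ hj => by simp [Matrix.one_apply_ne hj]) (by simp)]
    simp [Real.mul_self_sqrt (hlam i)]
  have hsplit (x : 𝒳) :
      (∑ a, ∑ b, if a = b then 0 else ev (canonPsi lam) (B x a ⊗ₖ (B x b)ᵀ)) =
        1 - ∑ a, ev (canonPsi lam) (B x a ⊗ₖ (B x a)ᵀ) := by
    rw [← htot x, ← Finset.sum_sub_distrib]
    refine Finset.sum_congr rfl fun a _ => ?_
    rw [eq_sub_iff_add_eq, ← Finset.sum_erase_add _ _ (Finset.mem_univ a), if_pos rfl, add_zero,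
      ← Finset.sum_erase_add (Finset.univ) (fun b => ev _ _) (Finset.mem_univ a)]
    congr 1
    exact Finset.sum_congr rfl fun b hb => if_neg (Finset.ne_of_mem_erase hb).symm
  simp only [deltaSync, hsplit, mul_sub, mul_one, Finset.sum_sub_distrib, hν.2]
  congr 1
  simp only [ev_canonPsi_kronecker, (hB _).mul_entry_symm, Complex.ofReal_re, entryWeight,
    Finset.mul_sum, Finset.sum_mul]
  rw [Finset.sum_congr rfl fun x _ => Finset.sum_comm, Finset.sum_comm]
  refine Finset.sum_congr rfl fun i _ => ?_
  rw [Finset.sum_congr rfl fun x _ => Finset.sum_comm, Finset.sum_comm]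
  exact Finset.sum_congr rfl fun j _ => Finset.sum_congr rfl fun x _ =>
    Finset.sum_congr rfl fun a _ => by ring

lemma integral_frob_commutator_Pdiag_sq {lam : n → ℝ} (hlam : ∀ i, 0 ≤ lam i)
    (B : 𝒳 → 𝒜 → Matrix n n ℂ) (ν : 𝒳 → ℝ) :
    (∫ t in Set.Ioi (0:ℝ),
        ∑ x, ν x * ∑ a, (frob (B x a * Pdiag lam t - Pdiag lam t * B x a)) ^ 2) =
      ∑ i, ∑ j, entryWeight ν B i j * |lam i - lam j| := by
  have hpt (t : ℝ) :
      ∑ x, ν x * ∑ a, (frob (B x a * Pdiag lam t - Pdiag lam t * B x a)) ^ 2 =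
        ∑ i, ∑ j, entryWeight ν B i j *
          (Set.Ioc (min (lam i) (lam j)) (max (lam i) (lam j))).indicator 1 t := by
    simp only [frob_commutator_Pdiag_sq, entryWeight, Finset.mul_sum, Finset.sum_mul]
    rw [Finset.sum_congr rfl fun x _ => Finset.sum_comm, Finset.sum_comm]
    refine Finset.sum_congr rfl fun i _ => ?_
    rw [Finset.sum_congr rfl fun x _ => Finset.sum_comm, Finset.sum_comm]
    exact Finset.sum_congr rfl fun j _ => Finset.sum_congr rfl fun x _ =>
      Finset.sum_congr rfl fun a _ => by ring
  simp_rw [hpt]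
  rw [integral_finsetSum _ fun i _ => integrable_finsetSum _ fun j _ =>
    (integrable_indicator_Ioc _ _).const_mul _]
  refine Finset.sum_congr rfl fun i _ => ?_
  rw [integral_finsetSum _ fun j _ => (integrable_indicator_Ioc _ _).const_mul _]
  refine Finset.sum_congr rfl fun j _ => ?_
  rw [integral_const_mul, setIntegral_indicator_Ioc_min_max (hlam i) (hlam j)]

end Weight

/-- Cauchy–Schwarz bound for a symmetric doubly stochastic weight. -/
lemma sum_mul_abs_sub_le {n : Type*} [Fintype n] {lam : n → ℝ} (hlam : ∀ i, 0 ≤ lam i)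
    (hlam1 : ∑ i, lam i = 1) {W : n → n → ℝ} (hW : ∀ i j, 0 ≤ W i j)
    (hsymm : ∀ i j, W i j = W j i) (hsum : ∀ i, ∑ j, W i j = 1) :
    ∑ i, ∑ j, W i j * |lam i - lam j| ≤
      2 * Real.sqrt (2 * (1 - ∑ i, ∑ j, W i j * (Real.sqrt (lam i) * Real.sqrt (lam j)))) := by
  set s : n → ℝ := fun i => Real.sqrt (lam i) with hs
  have hs0 (i) : 0 ≤ s i := Real.sqrt_nonneg _
  have hsq (i) : lam i = s i ^ 2 := (Real.sq_sqrt (hlam i)).symm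
  have hrow : ∑ i, ∑ j, W i j * s i ^ 2 = 1 := by
    simp_rw [← Finset.sum_mul, hsum, one_mul, ← hsq, hlam1]
  have hcol : ∑ i, ∑ j, W i j * s j ^ 2 = 1 := by
    rw [Finset.sum_comm, ← hrow]
    exact Finset.sum_congr rfl fun i _ => Finset.sum_congr rfl fun j _ => by rw [hsymm]
  set c := ∑ i, ∑ j, W i j * (s i * s j) with hc
  have hminus : ∑ p : n × n, W p.1 p.2 * |s p.1 - s p.2| ^ 2 = 2 * (1 - c) := by
    have : ∑ p : n × n, W p.1 p.2 * |s p.1 - s p.2| ^ 2 =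
        ∑ i, ∑ j, W i j * s i ^ 2 + ∑ i, ∑ j, W i j * s j ^ 2 - 2 * c := by
      simp only [Fintype.sum_prod_type, hc, Finset.mul_sum, ← Finset.sum_add_distrib,
        ← Finset.sum_sub_distrib, sq_abs]
      exact Finset.sum_congr rfl fun i _ => Finset.sum_congr rfl fun j _ => by ring
    rw [this, hrow, hcol]; ring
  have hplus : ∑ p : n × n, W p.1 p.2 * (s p.1 + s p.2) ^ 2 ≤ 2 ^ 2 := by
    have : ∑ p : n × n, W p.1 p.2 * (s p.1 + s p.2) ^ 2 ≤
        2 * ∑ i, ∑ j, W i j * s i ^ 2 + 2 * ∑ i, ∑ j, W i j * s j ^ 2 := by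
      simp only [Fintype.sum_prod_type, Finset.mul_sum, ← Finset.sum_add_distrib]
      refine Finset.sum_le_sum fun i _ => Finset.sum_le_sum fun j _ => ?_
      nlinarith [mul_nonneg (hW i j) (sq_nonneg (s i - s j))]
    rw [hrow, hcol] at this
    linarith
  have habs (i j) : W i j * |lam i - lam j| =
      (Real.sqrt (W i j) * (s i + s j)) * (Real.sqrt (W i j) * |s i - s j|) := by
    rw [hsq i, hsq j, sq_sub_sq, abs_mul, abs_of_nonneg (add_nonneg (hs0 i) (hs0 j))]
    nth_rewrite 1 [← Real.mul_self_sqrt (hW i j)]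
    ring
  simp_rw [habs]
  rw [← Fintype.sum_prod_type' (f := fun i j =>
    (Real.sqrt (W i j) * (s i + s j)) * (Real.sqrt (W i j) * |s i - s j|))]
  refine (Real.sum_mul_le_sqrt_mul_sqrt _ _ _).trans ?_
  simp_rw [mul_pow, Real.sq_sqrt (hW _ _)]
  rw [hminus]
  gcongr
  exact (Real.sqrt_le_left (by norm_num)).2 hplus

/-- Lemma `lambda-strat-1`: approximate commutation of a projective
symmetric strategy with the spectral projections of the reduced density:
`∫_0^∞ E_{x∼ν} Σ_a ‖B^x_a P_λ − P_λ B^x_a‖_F² dλ ≤ 2√(2δ′)`. -/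
theorem stmt16 {n 𝒳 𝒜 : Type*} [Fintype n] [DecidableEq n] [Fintype 𝒳] [Fintype 𝒜]
    [DecidableEq 𝒜]
    (lam : n → ℝ) (hlam : ∀ i, 0 ≤ lam i) (hlam1 : ∑ i, lam i = 1)
    (B : 𝒳 → 𝒜 → Matrix n n ℂ) (hB : ∀ x, IsProjMeas (B x))
    (ν : 𝒳 → ℝ) (hν : IsDist ν)
    (δ' : ℝ) (hδ' : δ' = deltaSync ν (canonPsi lam) B (fun x a => (B x a)ᵀ)) :
    (∫ t in Set.Ioi (0:ℝ),
        ∑ x, ν x * ∑ a, (frob (B x a * Pdiag lam t - Pdiag lam t * B x a)) ^ 2)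
      ≤ 2 * Real.sqrt (2 * δ') := by
  rw [hδ', integral_frob_commutator_Pdiag_sq hlam, deltaSync_canonPsi_transpose hlam hlam1 hB hν]
  exact sum_mul_abs_sub_le hlam hlam1 (entryWeight_nonneg hν B) (entryWeight_comm hB ν)
    (sum_entryWeight hB hν)

end AlmostSync
end
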